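/- Let S be a finite set and J ⊆ S a subset. Then the sum, over all finite chains c of subsets of S (totally ordered by inclusion) whose largest member is S and whose smallest member is J, of (−1)^{(card c) − 1}, equals (−1)^{card(S \ J)}. -/

import Mathlib

open scoped Classical

/-- The chains of subsets of a finite type that contain the whole type. -/
noncomputable def topChains (S : Type*) [Fintype S] : Finset (Finset (Finset S)) :=
  Finset.univ.filter fun c => IsChain (· ⊆ ·) (↑c : Set (Finset S)) ∧ Finset.univ ∈ c

theorem mem_topChains {S : Type*} [Fintype S] {c : Finset (Finset S)} :
    c ∈ topChains S ↔ IsChain (· ⊆ ·) (↑c : Set (Finset S)) ∧ Finset.univ ∈ c := by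
  simp [topChains]

/-- Adding or removing `J` is a sign-reversing involution on the chains with top element
`univ` all of whose members contain `J`. -/
theorem sum_topChains_le_inf_eq_zero {S : Type*} [Fintype S] {J : Finset S}
    (hJ : J ≠ Finset.univ) :
    ∑ c ∈ (topChains S).filter (fun c => J ≤ c.inf id), (-1 : ℤ) ^ (c.card - 1) = 0 := by
  refine Finset.sum_involution (fun c _ => if J ∈ c then c.erase J else insert J c)
    ?_ ?_ ?_ ?_
  · intro c hc
    obtain ⟨⟨-, hu⟩, -⟩ := by simpa only [Finset.mem_filter, mem_topChains] using hc
    split_ifs with h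
    · have hpos : 0 < (c.erase J).card :=
        Finset.card_pos.2 ⟨_, Finset.mem_erase.2 ⟨hJ.symm, hu⟩⟩
      obtain ⟨n, hn⟩ := Nat.exists_eq_succ_of_ne_zero hpos.ne'
      have hcard := Finset.card_erase_add_one h
      rw [← hcard, hn]
      simp [pow_succ]
    · obtain ⟨n, hn⟩ := Nat.exists_eq_succ_of_ne_zero (Finset.card_pos.2 ⟨_, hu⟩).ne'
      rw [Finset.card_insert_of_notMem h, hn]
      simp [pow_succ]
  · intro c _ _ h
    split_ifs at h with hm
    · exact Finset.erase_ne_self.2 hm h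
    · exact Finset.insert_ne_self.2 hm h
  · intro c hc
    obtain ⟨⟨hch, hu⟩, hle⟩ := by simpa only [Finset.mem_filter, mem_topChains] using hc
    rw [Finset.mem_filter, mem_topChains]
    split_ifs with h
    · exact ⟨⟨hch.mono (Finset.coe_subset.2 (Finset.erase_subset J c)),
        Finset.mem_erase.2 ⟨hJ.symm, hu⟩⟩,
        hle.trans (Finset.inf_mono (Finset.erase_subset J c))⟩
    · refine ⟨⟨?_, Finset.mem_insert_of_mem hu⟩, ?_⟩
      · rw [Finset.coe_insert]
        exact hch.insert fun K hK _ => Or.inl (Finset.le_inf_iff.1 hle K hK)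
      · rw [Finset.inf_insert]
        exact le_inf le_rfl hle
  · intro c _
    by_cases h : J ∈ c
    · simp [h, Finset.insert_erase h]
    · simp [h, Finset.erase_insert h]

theorem sum_superset_neg_one_pow_card_compl {S : Type*} [Fintype S] {J : Finset S}
    (hJ : J ≠ Finset.univ) :
    ∑ K ∈ Finset.Ici J, (-1 : ℤ) ^ Kᶜ.card = 0 := by
  rw [Finset.sum_bij' (t := Jᶜ.powerset) (g := fun m => (-1 : ℤ) ^ m.card)
    (fun K _ => Kᶜ) (fun m _ => mᶜ)]
  · rw [Finset.sum_powerset_neg_one_pow_card, if_neg]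
    rwa [Finset.compl_eq_empty_iff]
  · intro K hK
    exact Finset.mem_powerset.2 (Finset.compl_subset_compl.2 (Finset.mem_Ici.1 hK))
  · intro m hm
    exact Finset.mem_Ici.2 (le_compl_comm.1 (Finset.mem_powerset.1 hm))
  · simp
  · simp
  · simp

theorem sum_topChains_inf_eq {S : Type*} [Fintype S] (J : Finset S) :
    ∑ c ∈ (topChains S).filter (fun c => c.inf id = J), (-1 : ℤ) ^ (c.card - 1)
      = (-1 : ℤ) ^ Jᶜ.card := by
  induction J using WellFoundedGT.induction with
  | ind J ih =>
  by_cases hJ : J = Finset.univ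
  · have h : (topChains S).filter (fun c => c.inf id = J) = {{Finset.univ}} := by
      ext c
      rw [Finset.mem_filter, mem_topChains, Finset.mem_singleton]
      constructor
      · rintro ⟨⟨-, hu⟩, hinf⟩
        refine Finset.eq_singleton_iff_unique_mem.2 ⟨hu, fun K hK => ?_⟩
        exact top_le_iff.1 (((hinf.trans hJ).ge).trans (Finset.inf_le (f := id) hK))
      · rintro rfl
        simp [hJ]
    rw [h]
    simp [hJ]
  · have h : ∑ K ∈ Finset.Ici J, ∑ c ∈ (topChains S).filter (fun c => c.inf id = K),
        (-1 : ℤ) ^ (c.card - 1) = ∑ K ∈ Finset.Ici J, (-1 : ℤ) ^ Kᶜ.card := by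
      rw [sum_superset_neg_one_pow_card_compl hJ, ← sum_topChains_le_inf_eq_zero hJ,
        ← Finset.sum_fiberwise_of_maps_to (t := Finset.Ici J)
          (g := fun c : Finset (Finset S) => c.inf id)
          (fun c hc => Finset.mem_Ici.2 (Finset.mem_filter.1 hc).2)]
      refine Finset.sum_congr rfl fun K hK => Finset.sum_congr ?_ fun _ _ => rfl
      ext c
      have hK' := Finset.mem_Ici.1 hK
      simp only [Finset.mem_filter]
      constructor
      · rintro ⟨hc, rfl⟩
        exact ⟨⟨hc, hK'⟩, rfl⟩
      · rintro ⟨⟨hc, -⟩, h⟩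
        exact ⟨hc, h⟩
    rw [← Finset.Ioi_insert, Finset.sum_insert (by simp), Finset.sum_insert (by simp),
      Finset.sum_congr rfl fun K hK => ih K (Finset.mem_Ioi.1 hK)] at h
    exact add_right_cancel h

/-- Let `S` be a finite set and `J ⊆ S` a subset.  Then the sum, over all finite chains
`c` of subsets of `S` (totally ordered by inclusion) whose largest member is `S` and
whose smallest member is `J`, of `(−1)^{card c − 1}`, equals `(−1)^{card (S \ J)}`. -/
theorem sum_chains_top_min_eq {S : Type*} [Fintype S] (J : Finset S) :
    ∑ c ∈ Finset.univ.filter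
        (fun c : Finset (Finset S) =>
          IsChain (· ⊆ ·) (↑c : Set (Finset S)) ∧ Finset.univ ∈ c ∧ c.inf id = J),
      (-1 : ℤ) ^ (c.card - 1)
      = (-1 : ℤ) ^ (Finset.univ \ J).card := by
  have h := sum_topChains_inf_eq J
  rw [Finset.compl_eq_univ_sdiff, topChains, Finset.filter_filter] at h
  simpa only [and_assoc] using h
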